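/- The boundary complex of a stacked d-polytope on n vertices has exactly f_{i-1} = C(d, i-1)·n - C(d+1, i)·(i-1) faces of dimension i-1 for 1 ≤ i ≤ d-1, and f_{d-1} = (d-1)n - (d+1)(d-2) facets. -/

import Mathlib

open Finset

variable {V : Type*} [DecidableEq V]

/-- The boundary complexes of stacked `d`-polytopes, defined inductively:
the boundary of a `d`-simplex is stacked, and stacking glues a new `d`-simplex
along a facet (equivalently, replaces a facet `G` by the cone with apex a new
vertex `v` over the boundary of `G`). -/
inductive IsStackedBoundary (d : ℕ) : Set (Finset V) → Prop
  | simplex (S : Finset V) (hS : S.card = d + 1) :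
      IsStackedBoundary d {F | F ⊆ S ∧ F ≠ S}
  | stack (Δ : Set (Finset V)) (G : Finset V) (v : V)
      (hΔ : IsStackedBoundary d Δ) (hG : G ∈ Δ) (hGcard : G.card = d)
      (hv : ∀ F ∈ Δ, v ∉ F) :
      IsStackedBoundary d ((Δ \ {G}) ∪ {F | ∃ H, H ⊆ G ∧ H ≠ G ∧ F = insert v H})

lemma ncard_simplex_aux (d i : ℕ) (hi : i ≤ d) (S : Finset V) (hS : S.card = d + 1) :
    {F | F ∈ {F : Finset V | F ⊆ S ∧ F ≠ S} ∧ F.card = i}.ncard = (d + 1).choose i := by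
  have h : {F | F ∈ {F : Finset V | F ⊆ S ∧ F ≠ S} ∧ F.card = i}
      = ((S.powersetCard i : Finset (Finset V)) : Set (Finset V)) := by
    ext F
    simp only [Set.mem_ofPred_eq, Finset.mem_coe, Finset.mem_powersetCard]
    constructor
    · rintro ⟨⟨h1, _⟩, h2⟩
      exact ⟨h1, h2⟩
    · rintro ⟨h1, h2⟩
      refine ⟨⟨h1, ?_⟩, h2⟩
      rintro rfl
      omega
  rw [h, Set.ncard_coe_finset, Finset.card_powersetCard, hS]

lemma ncard_stack_aux (d i : ℕ) (hi1 : 1 ≤ i) (hi : i ≤ d) (Δ : Set (Finset V)) (hfin : Δ.Finite)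
    (G : Finset V) (v : V) (hG : G ∈ Δ) (hGcard : G.card = d) (hv : ∀ F ∈ Δ, v ∉ F) :
    {F | F ∈ ((Δ \ {G}) ∪ {F | ∃ H, H ⊆ G ∧ H ≠ G ∧ F = insert v H}) ∧ F.card = i}.ncard
      = ({F | F ∈ Δ ∧ F.card = i} \ {G}).ncard + d.choose (i - 1) := by
  have hvG : v ∉ G := hv G hG
  have h : {F | F ∈ ((Δ \ {G}) ∪ {F | ∃ H, H ⊆ G ∧ H ≠ G ∧ F = insert v H}) ∧ F.card = i}
      = ({F | F ∈ Δ ∧ F.card = i} \ {G}) ∪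
        (((G.powersetCard (i - 1)).image (insert v) : Finset (Finset V)) : Set (Finset V)) := by
    ext F
    simp only [Set.mem_ofPred_eq, Finset.mem_coe, Finset.mem_image, Finset.mem_powersetCard,
      Set.mem_union, Set.mem_sdiff, Set.mem_singleton_iff]
    constructor
    · rintro ⟨⟨h1, h2⟩ | ⟨H, h1, h2, rfl⟩, h3⟩
      · exact Or.inl ⟨⟨h1, h3⟩, h2⟩
      · right
        rw [Finset.card_insert_of_notMem (fun h => hvG (h1 h))] at h3
        exact ⟨H, ⟨h1, by omega⟩, rfl⟩
    · rintro (⟨⟨h1, h3⟩, h2⟩ | ⟨H, ⟨h1, h2⟩, rfl⟩)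
      · exact ⟨Or.inl ⟨h1, h2⟩, h3⟩
      · refine ⟨Or.inr ⟨H, h1, ?_, rfl⟩, ?_⟩
        · rintro rfl
          omega
        · rw [Finset.card_insert_of_notMem (fun h => hvG (h1 h))]
          omega
  rw [h, Set.ncard_union_eq ?_ ((hfin.subset (fun F hF => hF.1)).subset Set.sdiff_subset)
    (Finset.finite_toSet _), Set.ncard_coe_finset, Finset.card_image_of_injOn,
    Finset.card_powersetCard, hGcard]
  · intro A hA B hB hAB
    simp only [Finset.mem_coe, Finset.mem_powersetCard] at hA hB
    have := congrArg (fun X => Finset.erase X v) hAB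
    simpa [Finset.erase_insert (fun h => hvG (hA.1 h)),
      Finset.erase_insert (fun h => hvG (hB.1 h))] using this
  · rw [Set.disjoint_left]
    rintro F ⟨⟨h1, _⟩, _⟩ h2
    simp only [Finset.mem_coe, Finset.mem_image] at h2
    obtain ⟨H, _, rfl⟩ := h2
    exact hv _ h1 (Finset.mem_insert_self _ _)

lemma stacked_finite_aux (d : ℕ) (Δ : Set (Finset V)) (hΔ : IsStackedBoundary d Δ) :
    Δ.Finite := by
  induction hΔ with
  | simplex S hS =>
    exact (Finset.finite_toSet S.powerset).subset (fun F hF => by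
      simpa using hF.1)
  | stack Δ G v hΔ hG hGcard hv ih =>
    refine (ih.subset Set.sdiff_subset).union ?_
    refine (Finset.finite_toSet (G.powerset.image (insert v))).subset ?_
    rintro F ⟨H, h1, _, rfl⟩
    simp only [Finset.mem_coe, Finset.mem_image, Finset.mem_powerset]
    exact ⟨H, h1, rfl⟩

/-- The boundary complex of a stacked `d`-polytope on `n` vertices has exactly
`f_{i-1} = C(d,i-1)·n - C(d+1,i)·(i-1)` faces of dimension `i-1` for
`1 ≤ i ≤ d-1`, and `f_{d-1} = (d-1)·n - (d+1)·(d-2)` facets. -/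
theorem stacked_boundary_face_numbers (d n : ℕ) (hd : 2 ≤ d)
    (Δ : Set (Finset V)) (hΔ : IsStackedBoundary d Δ)
    (hn : {F | F ∈ Δ ∧ F.card = 1}.ncard = n) :
    (∀ i, 1 ≤ i → i ≤ d - 1 →
      ({F | F ∈ Δ ∧ F.card = i}.ncard : ℤ) =
        (d.choose (i - 1) : ℤ) * n - ((d + 1).choose i : ℤ) * ((i : ℤ) - 1)) ∧
    ({F | F ∈ Δ ∧ F.card = d}.ncard : ℤ) =
      ((d : ℤ) - 1) * n - ((d : ℤ) + 1) * ((d : ℤ) - 2) := by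
  subst hn
  induction hΔ with
  | simplex S hS =>
    rw [ncard_simplex_aux d 1 (by omega) S hS, ncard_simplex_aux d d le_rfl S hS]
    constructor
    · intro i h1 h2
      rw [ncard_simplex_aux d i (by omega) S hS]
      obtain ⟨j, rfl⟩ : ∃ j, i = j + 1 := ⟨i - 1, by omega⟩
      have h := Nat.add_one_mul_choose_eq d j
      have h' : ((d : ℤ) + 1) * (d.choose j : ℤ) = ((d + 1).choose (j + 1) : ℤ) * ((j : ℤ) + 1) := by
        exact_mod_cast h
      simp only [Nat.add_sub_cancel, Nat.choose_one_right]
      push_cast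
      linear_combination -h'
    · simp only [Nat.choose_one_right, Nat.choose_succ_self_right]
      push_cast
      ring
  | stack Δ G v hΔ hG hGcard hv ih =>
    have hfin := stacked_finite_aux d Δ hΔ
    have key : ∀ i, 1 ≤ i → i ≤ d - 1 →
        {F | F ∈ ((Δ \ {G}) ∪ {F | ∃ H, H ⊆ G ∧ H ≠ G ∧ F = insert v H}) ∧ F.card = i}.ncard
          = {F | F ∈ Δ ∧ F.card = i}.ncard + d.choose (i - 1) := by
      intro i h1 h2
      rw [ncard_stack_aux d i h1 (by omega) Δ hfin G v hG hGcard hv,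
        Set.sdiff_singleton_eq_self]
      rintro ⟨_, h⟩
      omega
    have keyd := ncard_stack_aux d d (by omega) le_rfl Δ hfin G v hG hGcard hv
    have hdel := Set.ncard_sdiff_singleton_add_one
      (show G ∈ {F | F ∈ Δ ∧ F.card = d} from ⟨hG, hGcard⟩)
      (hfin.subset (fun F hF => hF.1))
    have hch : d.choose (d - 1) = d := by
      obtain ⟨e, rfl⟩ : ∃ e, d = e + 1 := ⟨d - 1, by omega⟩
      simp
    rw [hch] at keyd
    obtain ⟨ih1, ih2⟩ := ih
    rw [key 1 le_rfl (by omega)]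
    constructor
    · intro i h1 h2
      rw [key i h1 h2]
      have := ih1 i h1 h2
      simp only [Nat.sub_self, Nat.choose_zero_right]
      push_cast
      linear_combination this
    · rw [keyd]
      simp only [Nat.sub_self, Nat.choose_zero_right]
      have hdel := congrArg (fun x : ℕ => (x : ℤ)) hdel
      simp only [Nat.cast_add, Nat.cast_one] at hdel
      push_cast
      linear_combination ih2 + hdel
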